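/- Let H be a Hilbert space, let C_1,…,C_n be injective positive commuting bounded operators on H with C_1+⋯+C_n = I, let P be the operator matrix (C_j^{1/2}C_k^{1/2})_{j,k} on H^n, and let P_j be the orthogonal projection onto the j-th coordinate subspace of H^n. Then for each j, (Im P)^⊥ ∩ Im P_j = {0} and Im P ∩ (Im P_j)^⊥ = {0}. -/

import Mathlib

open scoped InnerProductSpace
open Finset

/-- with `P` the operator matrix `(C j^{1/2} C k^{1/2})_{j,k}` on `H^n`
and `P_j` the projection onto the `j`-th coordinate subspace, the projections are in
generic position: `(Im P)ᗮ ∩ Im P_j = {0}` and `Im P ∩ (Im P_j)ᗮ = {0}`.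
Here `(Im P)ᗮ = {f | ∀ g, ⟪P g, f⟫ = 0}`, `Im P_j = {f | ∀ i ≠ j, f i = 0}` and
`(Im P_j)ᗮ = {f | f j = 0}`, with the direct-sum inner product `∑ i, ⟪· i, · i⟫`. -/
theorem stmt6 {H : Type*} [NormedAddCommGroup H] [InnerProductSpace ℂ H] [CompleteSpace H]
    (n : ℕ) (C : Fin n → (H →L[ℂ] H))
    (hinj : ∀ i, Function.Injective (C i))
    (hpos : ∀ i, (C i).IsPositive)
    (hcomm : ∀ i j, Commute (C i) (C j))
    (hsum : ∑ i, C i = 1)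
    (P : (Fin n → H) → (Fin n → H))
    (hP : ∀ f j, P f j = ∑ k, CFC.sqrt (C j) (CFC.sqrt (C k) (f k))) :
    ∀ j : Fin n,
      (∀ f : Fin n → H,
        (∀ g : Fin n → H, ∑ i, ⟪P g i, f i⟫_ℂ = 0) → (∀ i, i ≠ j → f i = 0) → f = 0) ∧
      (∀ f : Fin n → H, (∃ g, P g = f) → f j = 0 → f = 0) := by
  have hC : ∀ i, 0 ≤ C i := fun i => (ContinuousLinearMap.nonneg_iff_isPositive _).2 (hpos i)
  have hS : ∀ i x, CFC.sqrt (C i) (CFC.sqrt (C i) x) = C i x := by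
    intro i x
    have h := CFC.sqrt_mul_sqrt_self (C i) (hC i)
    exact congrArg (fun T : H →L[ℂ] H => T x) h
  have hz : ∀ i x, CFC.sqrt (C i) x = 0 → x = 0 := by
    intro i x hx
    apply hinj i
    rw [← hS, hx, map_zero, map_zero]
  intro j
  refine ⟨?_, ?_⟩
  · intro f hf hfj
    have h1 := hf f
    rw [Finset.sum_eq_single j (fun i _ hi => by rw [hfj i hi, inner_zero_right])
      (fun h => absurd (Finset.mem_univ j) h), hP,
      Finset.sum_eq_single j (fun i _ hi => by rw [hfj i hi, map_zero, map_zero])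
      (fun h => absurd (Finset.mem_univ j) h)] at h1
    have hp : (CFC.sqrt (C j)).IsPositive :=
      (ContinuousLinearMap.nonneg_iff_isPositive _).1 (CFC.sqrt_nonneg (C j))
    have h2 : ⟪CFC.sqrt (C j) (f j), CFC.sqrt (C j) (f j)⟫_ℂ = 0 := by
      rw [← h1]
      exact (hp.isSymmetric _ _).symm
    have h3 := hz j _ (inner_self_eq_zero.1 h2)
    funext i
    by_cases hi : i = j
    · rw [hi, h3]; rfl
    · exact hfj i hi
  · rintro f ⟨g, rfl⟩ h
    have h1 : ∀ i, P g i = CFC.sqrt (C i) (∑ k, CFC.sqrt (C k) (g k)) := by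
      intro i
      rw [hP, map_sum]
    rw [h1] at h
    funext i
    rw [h1, hz j _ h, map_zero]; rfl
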